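/- Fix a constant γ > 0 and a function d : ℕ → ℕ with d(n) ≥ 2 for all n and d(n)/√n → 0 as n → ∞. Then there exist a constant C > 0 and n0 such that for all n ≥ n0 with d(n)·n even, writing d = d(n) and i1 = ⌊(1+γ)(d−1)²/4⌋: for every i with 2 ≤ i ≤ i1 such that S_i is nonempty, if P is chosen uniformly at random from S_i, then the expected number of unordered pairs of two distinct double edges of P that share a common bin is at most C·i²/n. -/

import Mathlib

/-!
Formalization of the pairing model of random `d`-regular (multi)graphs and of the
switchings used in the uniform sampler *REG* of Gao and Wormald,
"Uniform generation of random regular graphs".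

Bins are elements of `Fin n`; each bin contains `d` points, so points are
elements of `Fin n × Fin d`.  A pairing is a perfect matching of the points,
modelled as a fixed-point-free involution on the points: the pairs of the
pairing are the orbits `{x, P.f x}`.
-/

namespace Reg

abbrev Point (n d : ℕ) := Fin n × Fin d

/-- A pairing: a perfect matching of the `d * n` points, encoded as a
fixed-point-free involution.  The pairs are the 2-element sets `{x, f x}`. -/
structure Pairing (n d : ℕ) where
  f : Point n d → Point n d
  invol : ∀ x, f (f x) = x
  nofix : ∀ x, f x ≠ x

instance {n d : ℕ} : Finite (Pairing n d) :=
  Finite.of_injective (fun P => P.f) fun P Q h => by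
    cases P; cases Q; congr

variable {n d : ℕ}

/-- The number of pairs of `P` with one point in bin `u` and one point in bin `v`
(for distinct bins `u ≠ v` this is the multiplicity of the edge `uv`). -/
def mult (P : Pairing n d) (u v : Fin n) : ℕ :=
  (Finset.univ.filter fun a : Point n d => a.1 = u ∧ (P.f a).1 = v).card

/-- Two bins are adjacent if some pair of the pairing joins them. -/
def Adj (P : Pairing n d) (u v : Fin n) : Prop := u ≠ v ∧ 1 ≤ mult P u v

/-- The number of loops of `P` (pairs whose two points lie in the same bin). -/
def numLoops (P : Pairing n d) : ℕ :=
  (Finset.univ.filter fun a : Point n d => (P.f a).1 = a.1).card / 2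

/-- The number of loops of `P` lying in bin `u`. -/
def loopsAt (P : Pairing n d) (u : Fin n) : ℕ :=
  (Finset.univ.filter fun a : Point n d => a.1 = u ∧ (P.f a).1 = u).card / 2

/-- The number of (unordered) pairs of distinct bins joined by exactly `k` pairs of `P`,
i.e. the number of edges of multiplicity exactly `k`. -/
def edgesWithMult (P : Pairing n d) (k : ℕ) : ℕ :=
  (Finset.univ.filter fun q : Fin n × Fin n => q.1 < q.2 ∧ mult P q.1 q.2 = k).card

/-- `M1 = dn` as a real number. -/
noncomputable def M1R (n d : ℕ) : ℝ := (d : ℝ) * n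

/-- `M2 = n d (d-1)` as a real number. -/
noncomputable def M2R (n d : ℕ) : ℝ := (n : ℝ) * d * ((d : ℝ) - 1)

/-- `M3 = n d (d-1) (d-2)` as a real number. -/
noncomputable def M3R (n d : ℕ) : ℝ := (n : ℝ) * d * ((d : ℝ) - 1) * ((d : ℝ) - 2)

/-- `i1 = ⌊(1+γ)(d-1)²/4⌋`. -/
noncomputable def i1Nat (d : ℕ) (γ : ℝ) : ℕ := (⌊(1 + γ) * ((d : ℝ) - 1) ^ 2 / 4⌋).toNat

/-- The stratum `S_i` of the double-edge reduction phase: pairings with no loops,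
every edge of multiplicity at most 2, and exactly `i` double edges. -/
def SD (n d i : ℕ) : Set (Pairing n d) :=
  {P | numLoops P = 0 ∧ (∀ u v : Fin n, u ≠ v → mult P u v ≤ 2) ∧ edgesWithMult P 2 = i}

/-- `Φ1 = ⋃_{0 ≤ i ≤ m} S_i`. -/
def Phi1 (n d m : ℕ) : Set (Pairing n d) := {P | ∃ i ≤ m, P ∈ SD n d i}

/-- The labelled data (points 1–8) of a d-switching. -/
structure DSwitch (n d : ℕ) where
  p1 : Point n d
  p2 : Point n d
  p3 : Point n d
  p4 : Point n d
  p5 : Point n d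
  p6 : Point n d
  p7 : Point n d
  p8 : Point n d

/-- The four target bin-pairs `u1u2, u1u3, v1v2, v1v3` of a d-switching. -/
def targets (s : DSwitch n d) : List (Fin n × Fin n) :=
  [(s.p1.1, s.p5.1), (s.p1.1, s.p7.1), (s.p2.1, s.p6.1), (s.p2.1, s.p8.1)]

/-- `s` is a valid d-switching on `P`. -/
def IsDSwitch (P : Pairing n d) (s : DSwitch n d) : Prop :=
  P.f s.p1 = s.p2 ∧ P.f s.p3 = s.p4 ∧ P.f s.p5 = s.p6 ∧ P.f s.p7 = s.p8 ∧
  s.p1.1 = s.p3.1 ∧ s.p2.1 = s.p4.1 ∧ s.p1 ≠ s.p3 ∧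
  mult P s.p1.1 s.p2.1 = 2 ∧ mult P s.p5.1 s.p6.1 = 1 ∧ mult P s.p7.1 s.p8.1 = 1 ∧
  [s.p1.1, s.p2.1, s.p5.1, s.p6.1, s.p7.1, s.p8.1].Pairwise (· ≠ ·)

/-- The number of target bin-pairs of `s` joined by at least one pair of `P`. -/
def joinedCount (P : Pairing n d) (s : DSwitch n d) : ℕ :=
  (targets s).countP fun t => decide (1 ≤ mult P t.1 t.2)

/-- A type I switching: a d-switching creating at most one new double edge. -/
def IsTypeI (P : Pairing n d) (s : DSwitch n d) : Prop :=
  IsDSwitch P s ∧ (∀ t ∈ targets s, mult P t.1 t.2 ≤ 1) ∧ joinedCount P s ≤ 1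

/-- A type I switching of class A: it creates no new double edge. -/
def IsTypeIA (P : Pairing n d) (s : DSwitch n d) : Prop := IsTypeI P s ∧ joinedCount P s = 0

/-- A type I switching of class B: it creates exactly one new double edge. -/
def IsTypeIB (P : Pairing n d) (s : DSwitch n d) : Prop := IsTypeI P s ∧ joinedCount P s = 1

/-- The labelled data (points 1–12) of a type II switching. -/
structure DSwitch2 (n d : ℕ) extends DSwitch n d where
  p9 : Point n d
  p10 : Point n d
  p11 : Point n d
  p12 : Point n d

/-- A type II switching: a d-switching creating exactly two new double edges, both
incident with `u1` or both incident with `v1`, together with the labelling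
`{9,10}, {11,12}` (with 9 and 12 in `u1`, resp. `v1`) of the two existing pairs
joining the two joined target bin-pairs. -/
def IsTypeII (P : Pairing n d) (s : DSwitch2 n d) : Prop :=
  IsDSwitch P s.toDSwitch ∧ (∀ t ∈ targets s.toDSwitch, mult P t.1 t.2 ≤ 1) ∧
  P.f s.p9 = s.p10 ∧ P.f s.p11 = s.p12 ∧
  ((s.p9.1 = s.p1.1 ∧ s.p12.1 = s.p1.1 ∧
      ((s.p10.1 = s.p5.1 ∧ s.p11.1 = s.p7.1) ∨ (s.p10.1 = s.p7.1 ∧ s.p11.1 = s.p5.1)) ∧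
      mult P s.p1.1 s.p5.1 = 1 ∧ mult P s.p1.1 s.p7.1 = 1 ∧
      mult P s.p2.1 s.p6.1 = 0 ∧ mult P s.p2.1 s.p8.1 = 0) ∨
    (s.p9.1 = s.p2.1 ∧ s.p12.1 = s.p2.1 ∧
      ((s.p10.1 = s.p6.1 ∧ s.p11.1 = s.p8.1) ∨ (s.p10.1 = s.p8.1 ∧ s.p11.1 = s.p6.1)) ∧
      mult P s.p2.1 s.p6.1 = 1 ∧ mult P s.p2.1 s.p8.1 = 1 ∧
      mult P s.p1.1 s.p5.1 = 0 ∧ mult P s.p1.1 s.p7.1 = 0))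

/-- Conjugating a pairing by a permutation of the points: the pairs of
`conj P τ` are the images under `τ` of the pairs of `P`. -/
def conj (P : Pairing n d) (τ : Equiv.Perm (Point n d)) : Pairing n d where
  f := fun x => τ (P.f (τ.symm x))
  invol := by intro x; simp [P.invol]
  nofix := by
    intro x h
    refine P.nofix (τ.symm x) ?_
    have h3 := congrArg τ.symm h
    simpa using h3

/-- The permutation performing a d-switching: it replaces the pairs
`{1,2},{3,4},{5,6},{7,8}` by `{1,5},{3,7},{2,6},{4,8}`. -/
def dtau (s : DSwitch n d) : Equiv.Perm (Point n d) :=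
  (Equiv.swap s.p4 s.p7).trans (Equiv.swap s.p2 s.p5)

/-- The pairing resulting from performing a d-switching. -/
def dResult (P : Pairing n d) (s : DSwitch n d) : Pairing n d := conj P (dtau s)

/-- `f_I(P)`: the number of type I switchings on `P`. -/
noncomputable def fI (P : Pairing n d) : ℕ := Nat.card {s : DSwitch n d // IsTypeI P s}

/-- `f_II(P)`: the number of type II switchings on `P`. -/
noncomputable def fII (P : Pairing n d) : ℕ := Nat.card {s : DSwitch2 n d // IsTypeII P s}

/-- `b_A(P)`: the number of class A switchings from pairings in `Φ1` producing `P`. -/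
noncomputable def bA (m : ℕ) (P : Pairing n d) : ℕ :=
  Nat.card {q : Pairing n d × DSwitch n d //
    q.1 ∈ Phi1 n d m ∧ IsTypeIA q.1 q.2 ∧ dResult q.1 q.2 = P}

/-- `b_B(P)`: the number of class B switchings (of type I or type II) from
pairings in `Φ1` producing `P`. -/
noncomputable def bB (m : ℕ) (P : Pairing n d) : ℕ :=
  Nat.card {q : Pairing n d × DSwitch n d //
    q.1 ∈ Phi1 n d m ∧ IsTypeIB q.1 q.2 ∧ dResult q.1 q.2 = P} +
  Nat.card {q : Pairing n d × DSwitch2 n d //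
    q.1 ∈ Phi1 n d m ∧ IsTypeII q.1 q.2 ∧ dResult q.1 q.2.toDSwitch = P}

/-- `B_D = ⌊(1+γ)(d-1)²/4⌋`. -/
noncomputable def BD (d : ℕ) (γ : ℝ) : ℕ := i1Nat d γ

/-- `B_L = max(⌈log dn⌉, 4d)`. -/
noncomputable def BL (n d : ℕ) : ℕ := max (⌈Real.log ((d : ℝ) * n)⌉.toNat) (4 * d)

/-- `B_T = max(⌈log dn⌉, ⌈d³/n⌉)`. -/
noncomputable def BT (n d : ℕ) : ℕ :=
  max (⌈Real.log ((d : ℝ) * n)⌉.toNat) (⌈(d : ℝ) ^ 3 / (n : ℝ)⌉.toNat)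

/-- The set `A` of pairings that are not initially rejected:
`D(P) ≤ B_D`, `L(P) ≤ B_L` and `T(P) ≤ B_T`. -/
def AccSet (n d : ℕ) (γ : ℝ) : Set (Pairing n d) :=
  {P | edgesWithMult P 2 ≤ BD d γ ∧ numLoops P ≤ BL n d ∧ edgesWithMult P 3 ≤ BT n d}

/-- The stratum `S^L_i` of the loop reduction phase. -/
def SL (n d : ℕ) (γ : ℝ) (i : ℕ) : Set (Pairing n d) :=
  {P | numLoops P = i ∧ (∀ u : Fin n, loopsAt P u ≤ 1) ∧
    edgesWithMult P 2 ≤ BD d γ ∧ edgesWithMult P 3 ≤ BT n d ∧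
    ∀ u v : Fin n, u ≠ v → mult P u v ≤ 3}

/-- The labelled data (points 1–6) of a type L switching. -/
structure LSwitch (n d : ℕ) where
  q1 : Point n d
  q2 : Point n d
  q3 : Point n d
  q4 : Point n d
  q5 : Point n d
  q6 : Point n d

/-- `s` is a valid type L switching on `P`. -/
def IsLSwitch (P : Pairing n d) (s : LSwitch n d) : Prop :=
  P.f s.q1 = s.q2 ∧ s.q1.1 = s.q2.1 ∧
  P.f s.q3 = s.q4 ∧ P.f s.q5 = s.q6 ∧
  mult P s.q3.1 s.q4.1 = 1 ∧ mult P s.q5.1 s.q6.1 = 1 ∧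
  [s.q1.1, s.q3.1, s.q4.1, s.q5.1, s.q6.1].Pairwise (· ≠ ·) ∧
  mult P s.q1.1 s.q3.1 = 0 ∧ mult P s.q1.1 s.q5.1 = 0 ∧ mult P s.q4.1 s.q6.1 = 0

/-- The permutation performing a type L switching: it replaces the pairs
`{1,2},{3,4},{5,6}` by `{1,3},{2,5},{4,6}`. -/
def ltau (s : LSwitch n d) : Equiv.Perm (Point n d) :=
  (Equiv.swap s.q4 s.q5).trans (Equiv.swap s.q2 s.q3)

/-- The pairing resulting from performing a type L switching. -/
def lResult (P : Pairing n d) (s : LSwitch n d) : Pairing n d := conj P (ltau s)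

/-- `f_L(P)`: the number of type L switchings on `P`. -/
noncomputable def fL (P : Pairing n d) : ℕ := Nat.card {s : LSwitch n d // IsLSwitch P s}

/-- `b_A^L(P)`: the number of type L switchings from pairings in
`⋃_{0 ≤ j ≤ B_L} S^L_j` producing `P`. -/
noncomputable def bAL (γ : ℝ) (P : Pairing n d) : ℕ :=
  Nat.card {q : Pairing n d × LSwitch n d //
    (∃ j ≤ BL n d, q.1 ∈ SL n d γ j) ∧ IsLSwitch q.1 q.2 ∧ lResult q.1 q.2 = P}

/-- The stratum `S^T_i` of the triple-edge reduction phase. -/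
def ST (n d : ℕ) (γ : ℝ) (i : ℕ) : Set (Pairing n d) :=
  {P | numLoops P = 0 ∧ edgesWithMult P 3 = i ∧ edgesWithMult P 2 ≤ BD d γ ∧
    ∀ u v : Fin n, u ≠ v → mult P u v ≤ 3}

/-- The labelled data (points 1–12) of a type T switching. -/
structure TSwitch (n d : ℕ) where
  r1 : Point n d
  r2 : Point n d
  r3 : Point n d
  r4 : Point n d
  r5 : Point n d
  r6 : Point n d
  r7 : Point n d
  r8 : Point n d
  r9 : Point n d
  r10 : Point n d
  r11 : Point n d
  r12 : Point n d

/-- `s` is a valid type T switching on `P`. -/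
def IsTSwitch (P : Pairing n d) (s : TSwitch n d) : Prop :=
  P.f s.r1 = s.r2 ∧ P.f s.r3 = s.r4 ∧ P.f s.r5 = s.r6 ∧
  P.f s.r7 = s.r8 ∧ P.f s.r9 = s.r10 ∧ P.f s.r11 = s.r12 ∧
  s.r1.1 = s.r3.1 ∧ s.r3.1 = s.r5.1 ∧ s.r2.1 = s.r4.1 ∧ s.r4.1 = s.r6.1 ∧
  s.r1 ≠ s.r3 ∧ s.r3 ≠ s.r5 ∧ s.r1 ≠ s.r5 ∧
  mult P s.r1.1 s.r2.1 = 3 ∧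
  mult P s.r7.1 s.r8.1 = 1 ∧ mult P s.r9.1 s.r10.1 = 1 ∧ mult P s.r11.1 s.r12.1 = 1 ∧
  [s.r1.1, s.r2.1, s.r7.1, s.r8.1, s.r9.1, s.r10.1, s.r11.1, s.r12.1].Pairwise (· ≠ ·) ∧
  mult P s.r1.1 s.r7.1 = 0 ∧ mult P s.r1.1 s.r9.1 = 0 ∧ mult P s.r1.1 s.r11.1 = 0 ∧
  mult P s.r2.1 s.r8.1 = 0 ∧ mult P s.r2.1 s.r10.1 = 0 ∧ mult P s.r2.1 s.r12.1 = 0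

/-- The permutation performing a type T switching: it replaces the pairs
`{1,2},{3,4},{5,6},{7,8},{9,10},{11,12}` by `{1,7},{2,8},{3,9},{4,10},{5,11},{6,12}`. -/
def ttau (s : TSwitch n d) : Equiv.Perm (Point n d) :=
  ((Equiv.swap s.r2 s.r7).trans (Equiv.swap s.r4 s.r9)).trans (Equiv.swap s.r6 s.r11)

/-- The pairing resulting from performing a type T switching. -/
def tResult (P : Pairing n d) (s : TSwitch n d) : Pairing n d := conj P (ttau s)

/-- `f_T(P)`: the number of type T switchings on `P`. -/
noncomputable def fT (P : Pairing n d) : ℕ := Nat.card {s : TSwitch n d // IsTSwitch P s}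

/-- `b_A^T(P)`: the number of type T switchings from pairings in
`⋃_{0 ≤ j ≤ B_T} S^T_j` producing `P`. -/
noncomputable def bAT (γ : ℝ) (P : Pairing n d) : ℕ :=
  Nat.card {q : Pairing n d × TSwitch n d //
    (∃ j ≤ BT n d, q.1 ∈ ST n d γ j) ∧ IsTSwitch q.1 q.2 ∧ tResult q.1 q.2 = P}

/-- The endpoints of the pair of `P` containing the point `a` lie in bins
`w1, w2` such that `u, v, w1, w2` are four distinct bins, `w1` is adjacent to `u`
and `w2` is adjacent to `v`. -/
def GoodPair (u v : Fin n) (P : Pairing n d) (a : Point n d) : Prop :=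
  ∃ w1 w2 : Fin n,
    ((w1 = a.1 ∧ w2 = (P.f a).1) ∨ (w1 = (P.f a).1 ∧ w2 = a.1)) ∧
    [u, v, w1, w2].Pairwise (· ≠ ·) ∧ Adj P w1 u ∧ Adj P w2 v

/-- Four times the number of unordered pairs `{e, e'}` of distinct pairs of `P`
joining the same two distinct bins: ordered pairs of points `(a, b)` lying in a
common bin whose mates also lie in a common (different) bin. -/
def parallelOrdered (P : Pairing n d) : ℕ :=
  (Finset.univ.filter fun q : Point n d × Point n d =>
    q.1.1 = q.2.1 ∧ (P.f q.1).1 = (P.f q.2).1 ∧ q.1.1 ≠ (P.f q.1).1 ∧ q.1 ≠ q.2).card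

/-- Twice the number of unordered pairs of two distinct double edges of `P`
sharing a common bin (double edges being recorded as ordered bin-pairs `(u,v)`
with `u < v`). -/
def doubleSharedOrdered (P : Pairing n d) : ℕ :=
  (Finset.univ.filter fun q : (Fin n × Fin n) × (Fin n × Fin n) =>
    q.1.1 < q.1.2 ∧ q.2.1 < q.2.2 ∧ mult P q.1.1 q.1.2 = 2 ∧ mult P q.2.1 q.2.2 = 2 ∧
    q.1 ≠ q.2 ∧
    (q.1.1 = q.2.1 ∨ q.1.1 = q.2.2 ∨ q.1.2 = q.2.1 ∨ q.1.2 = q.2.2)).card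

/-- `m̄_I(i) = 4 i (M1 - 4i)²`. -/
noncomputable def mbarIp (nR dR : ℝ) (i : ℕ) : ℝ := 4 * i * (dR * nR - 4 * i) ^ 2

/-- `m̄_II(i) = 16 i (d-1)² (d-2) (d-3)`. -/
noncomputable def mbarIIp (dR : ℝ) (i : ℕ) : ℝ :=
  16 * i * (dR - 1) ^ 2 * (dR - 2) * (dR - 3)

/-- `m̲_A(i) = M2² - M2 (d-1) (16 i + 3d² + d + 6)`. -/
noncomputable def mAp (nR dR : ℝ) (i : ℕ) : ℝ :=
  (nR * dR * (dR - 1)) ^ 2 - nR * dR * (dR - 1) * (dR - 1) * (16 * i + 3 * dR ^ 2 + dR + 6)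

/-- `m̲_B(i) = 16 i (d-2) M2 - 16 i d (8 i d + 9 d² + 3 d³)`. -/
noncomputable def mBp (nR dR : ℝ) (i : ℕ) : ℝ :=
  16 * i * (dR - 2) * (nR * dR * (dR - 1)) - 16 * i * dR * (8 * i * dR + 9 * dR ^ 2 + 3 * dR ^ 3)

/-- The system of equations (18)–(21) of the paper determining the type
probabilities `ρ_I, ρ_II` and the (scaled) expected numbers of visits `x_j`,
together with the positivity requirement on the `x_j`. -/
def Sys (nR dR ε : ℝ) (m : ℕ) (x ρI ρII : ℕ → ℝ) : Prop :=
  (∀ j ≤ m, 0 < x j) ∧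
  (∀ i : ℕ, 1 ≤ i → i ≤ m → ρI i = 1 - ε) ∧
  ρI 0 = 0 ∧ ρII 0 = 0 ∧ ρII m = 0 ∧
  (∀ j : ℕ, 1 ≤ j → j + 1 ≤ m →
    x j = 1 + x (j + 1) * ρI (j + 1) * mAp nR dR j / mbarIp nR dR (j + 1)
        + x j * ρI j * mBp nR dR j / mbarIp nR dR j) ∧
  (x m = 1 + x m * ρI m * mBp nR dR m / mbarIp nR dR m) ∧
  (x 0 = 1 + x 1 * ρI 1 * mAp nR dR 0 / mbarIp nR dR 1) ∧
  (∀ j : ℕ, j + 1 ≤ m →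
    ρII j = ρI (j + 1) * (x (j + 1) / x j) * (mbarIIp dR j / mbarIp nR dR (j + 1)))

/-- The explicit unique positive root `x(d)`. -/
noncomputable def xd (dR : ℝ) : ℝ :=
  (7 / 2) * dR - 7 / 2 + 5 / dR +
    (1 / (2 * dR)) * Real.sqrt (65 * dR ^ 4 - 210 * dR ^ 3 + 461 * dR ^ 2 - 412 * dR + 196)

theorem mult_eq_sum (P : Pairing n d) (s t : Fin n) :
    mult P s t = ∑ x : Point n d, if x.1 = s ∧ (P.f x).1 = t then 1 else 0 := by
  simp [mult]

theorem mult_comm (P : Pairing n d) (s t : Fin n) : mult P s t = mult P t s := by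
  unfold mult
  refine Finset.card_bij' (fun x _ => P.f x) (fun x _ => P.f x) ?_ ?_ ?_ ?_ <;>
    simp +contextual [P.invol]

theorem Pairing.ext' {P Q : Pairing n d} (h : ∀ x, P.f x = Q.f x) : P = Q := by
  cases P; cases Q; congr; exact funext h

/-- Two pairings that agree off a finite list of points: comparing multiplicities. -/
theorem mult_add_sum_eq (P Q : Pairing n d) (l : List (Point n d)) (hl : l.Nodup)
    (h : ∀ x, x ∉ l → Q.f x = P.f x) (s t : Fin n) :
    mult Q s t + (l.map fun x => if x.1 = s ∧ (P.f x).1 = t then 1 else 0).sum =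
      mult P s t + (l.map fun x => if x.1 = s ∧ (Q.f x).1 = t then 1 else 0).sum := by
  classical
  rw [mult_eq_sum, mult_eq_sum, ← List.sum_toFinset _ hl, ← List.sum_toFinset _ hl,
    ← Finset.sum_add_sum_compl l.toFinset,
    ← Finset.sum_add_sum_compl l.toFinset (fun x => if x.1 = s ∧ (P.f x).1 = t then 1 else 0)]
  have : ∑ x ∈ l.toFinsetᶜ, (if x.1 = s ∧ (Q.f x).1 = t then 1 else 0) =
      ∑ x ∈ l.toFinsetᶜ, (if x.1 = s ∧ (P.f x).1 = t then 1 else 0) := by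
    refine Finset.sum_congr rfl fun x hx => ?_
    rw [h x (by simpa using hx)]
  omega

/-- The eight points involved in a switching. -/
def switchPoints (P : Pairing n d) (a b c e : Point n d) : List (Point n d) :=
  [a, P.f a, b, P.f b, c, P.f c, e, P.f e]

/-- The pairing in which the partners of `P.f a` and `c`, and those of `P.f b` and `e`,
are exchanged. -/
def switched (P : Pairing n d) (a b c e : Point n d) : Pairing n d :=
  conj P ((Equiv.swap (P.f b) e).trans (Equiv.swap (P.f a) c))

theorem switched_values {P : Pairing n d} {a b c e : Point n d}
    (h : (switchPoints P a b c e).Nodup) :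
    (switched P a b c e).f a = c ∧ (switched P a b c e).f (P.f a) = P.f c ∧
    (switched P a b c e).f b = e ∧ (switched P a b c e).f (P.f b) = P.f e ∧
    (switched P a b c e).f c = a ∧ (switched P a b c e).f (P.f c) = P.f a ∧
    (switched P a b c e).f e = b ∧ (switched P a b c e).f (P.f e) = P.f b := by
  simp only [switchPoints, List.nodup_cons, List.mem_cons, not_or, List.not_mem_nil,
    not_false_eq_true, List.nodup_nil, and_true] at h
  simp only [switched, conj, Equiv.symm_trans_apply, Equiv.trans_apply, Equiv.symm_swap,
    Equiv.swap_apply_def]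
  have ia := P.invol a
  have ib := P.invol b
  have ic := P.invol c
  have ie := P.invol e
  refine ⟨?_, ?_, ?_, ?_, ?_, ?_, ?_, ?_⟩ <;> grind

theorem switched_of_notMem {P : Pairing n d} {a b c e : Point n d}
    (h : (switchPoints P a b c e).Nodup) {x : Point n d} (hx : x ∉ switchPoints P a b c e) :
    (switched P a b c e).f x = P.f x := by
  simp only [switchPoints, List.nodup_cons, List.mem_cons, not_or, List.not_mem_nil,
    not_false_eq_true, List.nodup_nil, and_true] at h hx
  simp only [switched, conj, Equiv.symm_trans_apply, Equiv.trans_apply, Equiv.symm_swap]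
  have ix := P.invol x
  rw [Equiv.swap_apply_of_ne_of_ne (a := P.f a), Equiv.swap_apply_of_ne_of_ne (a := P.f b),
    Equiv.swap_apply_of_ne_of_ne (a := P.f b), Equiv.swap_apply_of_ne_of_ne (a := P.f a)] <;>
  grind [Pairing.invol]

theorem switched_switched {P : Pairing n d} {a b c e : Point n d}
    (h : (switchPoints P a b c e).Nodup) :
    switched (switched P a b c e) a b (P.f a) (P.f b) = P := by
  obtain ⟨h1, -, h2, -⟩ := switched_values h
  apply Pairing.ext'
  intro x
  rw [switched, h1, h2, switched]
  simp only [switchPoints, List.nodup_cons, List.mem_cons, not_or, List.not_mem_nil,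
    not_false_eq_true, List.nodup_nil, and_true] at h
  have key' : ∀ y, Equiv.swap c (P.f a) (Equiv.swap e (P.f b)
      (Equiv.swap (P.f a) c (Equiv.swap (P.f b) e y))) = y := by
    intro y
    simp only [Equiv.swap_apply_def]
    grind
  have key2 : ∀ y, Equiv.swap (P.f b) e (Equiv.swap (P.f a) c
      (Equiv.swap e (P.f b) (Equiv.swap c (P.f a) y))) = y := by
    intro y
    simp only [Equiv.swap_apply_def]
    grind
  simp only [conj, Equiv.symm_trans_apply, Equiv.trans_apply, Equiv.symm_swap, key2, key']

theorem mult_switched {P : Pairing n d} {a b c e : Point n d}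
    (h : (switchPoints P a b c e).Nodup) (s t : Fin n) :
    mult (switched P a b c e) s t +
      (((if a.1 = s ∧ (P.f a).1 = t then 1 else 0) + (if (P.f a).1 = s ∧ a.1 = t then 1 else 0)) +
       ((if b.1 = s ∧ (P.f b).1 = t then 1 else 0) + (if (P.f b).1 = s ∧ b.1 = t then 1 else 0)) +
       ((if c.1 = s ∧ (P.f c).1 = t then 1 else 0) + (if (P.f c).1 = s ∧ c.1 = t then 1 else 0)) +
       ((if e.1 = s ∧ (P.f e).1 = t then 1 else 0) + (if (P.f e).1 = s ∧ e.1 = t then 1 else 0))) =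
    mult P s t +
      (((if a.1 = s ∧ c.1 = t then 1 else 0) + (if c.1 = s ∧ a.1 = t then 1 else 0)) +
       ((if b.1 = s ∧ e.1 = t then 1 else 0) + (if e.1 = s ∧ b.1 = t then 1 else 0)) +
       ((if (P.f a).1 = s ∧ (P.f c).1 = t then 1 else 0) +
         (if (P.f c).1 = s ∧ (P.f a).1 = t then 1 else 0)) +
       ((if (P.f b).1 = s ∧ (P.f e).1 = t then 1 else 0) +
         (if (P.f e).1 = s ∧ (P.f b).1 = t then 1 else 0))) := by
  have H := mult_add_sum_eq P (switched P a b c e) _ h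
    (fun x hx => switched_of_notMem h hx) s t
  obtain ⟨h1, h2, h3, h4, h5, h6, h7, h8⟩ := switched_values h
  simp only [switchPoints, List.map_cons, List.map_nil, List.sum_cons, List.sum_nil, h1, h2, h3,
    h4, h5, h6, h7, h8, P.invol] at H
  omega

/-- Six pairwise distinct bins. -/
def Distinct6 (u v x y z w : Fin n) : Prop := [u, v, x, y, z, w].Nodup

/-- `m'` arises from `m` by moving two units from `uv` and one unit from each of `xy`, `zw`
to `ux`, `uz`, `vy`, `vw`. -/
def MultMove (m m' : Fin n → Fin n → ℕ) (u v x y z w : Fin n) : Prop :=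
  ∀ s t, m' s t +
      (2 * ((if u = s ∧ v = t then 1 else 0) + (if v = s ∧ u = t then 1 else 0)) +
       ((if x = s ∧ y = t then 1 else 0) + (if y = s ∧ x = t then 1 else 0)) +
       ((if z = s ∧ w = t then 1 else 0) + (if w = s ∧ z = t then 1 else 0))) =
    m s t +
      (((if u = s ∧ x = t then 1 else 0) + (if x = s ∧ u = t then 1 else 0)) +
       ((if u = s ∧ z = t then 1 else 0) + (if z = s ∧ u = t then 1 else 0)) +
       ((if v = s ∧ y = t then 1 else 0) + (if y = s ∧ v = t then 1 else 0)) +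
       ((if v = s ∧ w = t then 1 else 0) + (if w = s ∧ v = t then 1 else 0)))

theorem MultMove.values {m m' : Fin n → Fin n → ℕ} {u v x y z w : Fin n}
    (h : MultMove m m' u v x y z w) (hd : Distinct6 u v x y z w) :
    m' u v + 2 = m u v ∧ m' x y + 1 = m x y ∧ m' z w + 1 = m z w ∧
    m' u x = m u x + 1 ∧ m' u z = m u z + 1 ∧ m' v y = m v y + 1 ∧ m' v w = m v w + 1 := by
  simp only [Distinct6, List.nodup_cons, List.mem_cons, not_or, List.not_mem_nil,
    not_false_eq_true, List.nodup_nil, and_true] at hd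
  have h1 := h u v
  have h2 := h x y
  have h3 := h z w
  have h4 := h u x
  have h5 := h u z
  have h6 := h v y
  have h7 := h v w
  refine ⟨?_, ?_, ?_, ?_, ?_, ?_, ?_⟩ <;> grind

theorem MultMove.eq_or {m m' : Fin n → Fin n → ℕ} {u v x y z w : Fin n}
    (h : MultMove m m' u v x y z w) (hd : Distinct6 u v x y z w)
    (hm : ∀ s t, m s t = m t s) (hm' : ∀ s t, m' s t = m' t s)
    (huv : m u v = 2) (hxy : m x y = 1) (hzw : m z w = 1)
    (hux : m u x = 0) (huz : m u z = 0) (hvy : m v y = 0) (hvw : m v w = 0) (s t : Fin n) :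
    ((s, t) = (u, v) ∨ (s, t) = (v, u)) ∧ m s t = 2 ∧ m' s t = 0 ∨
    ((s, t) ≠ (u, v) ∧ (s, t) ≠ (v, u)) ∧ s ≠ t ∧ m s t ≤ 1 ∧ m' s t ≤ 1 ∨
    ((s, t) ≠ (u, v) ∧ (s, t) ≠ (v, u)) ∧ m s t = m' s t := by
  have hval := h.values hd
  have hst := h s t
  by_cases h1 : (s = u ∧ t = v) ∨ (s = v ∧ t = u)
  · grind
  simp only [Distinct6, List.nodup_cons, List.mem_cons, not_or, List.not_mem_nil,
    not_false_eq_true, List.nodup_nil, and_true] at hd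
  by_cases h2 : (s = x ∧ t = y) ∨ (s = y ∧ t = x)
  · grind
  by_cases h3 : (s = z ∧ t = w) ∨ (s = w ∧ t = z)
  · grind
  by_cases h4 : (s = u ∧ t = x) ∨ (s = x ∧ t = u)
  · grind
  by_cases h5 : (s = u ∧ t = z) ∨ (s = z ∧ t = u)
  · grind
  by_cases h6 : (s = v ∧ t = y) ∨ (s = y ∧ t = v)
  · grind
  by_cases h7 : (s = v ∧ t = w) ∨ (s = w ∧ t = v)
  · grind
  right; right
  refine ⟨by grind, ?_⟩
  push Not at h1 h2 h3 h4 h5 h6 h7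
  grind

/-- The ordered bin pairs joined by exactly two pairs of `P`. -/
def doubles (P : Pairing n d) : Finset (Fin n × Fin n) :=
  Finset.univ.filter fun q => mult P q.1 q.2 = 2

theorem mult_self_eq_zero_iff (P : Pairing n d) :
    (∀ s, mult P s s = 0) ↔ ∀ x, (P.f x).1 ≠ x.1 := by
  simp only [mult, Finset.card_eq_zero, Finset.filter_eq_empty_iff, Finset.mem_univ,
    forall_true_left]
  constructor
  · intro h x hx
    exact h x.1 ⟨rfl, hx⟩
  · rintro h s x ⟨rfl, hx⟩
    exact h x hx

theorem numLoops_eq_zero_iff (P : Pairing n d) :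
    numLoops P = 0 ↔ ∀ s, mult P s s = 0 := by
  rw [mult_self_eq_zero_iff]
  constructor
  · intro h x hx
    have h1 : (Finset.univ.filter fun a : Point n d => (P.f a).1 = a.1).card ≤ 1 := by
      unfold numLoops at h; omega
    rw [Finset.card_le_one] at h1
    exact P.nofix x (h1 _ (by simp [P.invol, hx]) _ (by simp [hx]))
  · intro h
    simp [numLoops, h]

theorem card_doubles (P : Pairing n d) (h : ∀ s, mult P s s = 0) :
    (doubles P).card = 2 * edgesWithMult P 2 := by
  have h1 : doubles P = (Finset.univ.filter fun q : Fin n × Fin n =>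
      q.1 < q.2 ∧ mult P q.1 q.2 = 2) ∪ (Finset.univ.filter fun q : Fin n × Fin n =>
      q.2 < q.1 ∧ mult P q.1 q.2 = 2) := by
    ext ⟨s, t⟩
    simp only [doubles, Finset.mem_filter, Finset.mem_univ, true_and, Finset.mem_union]
    rcases lt_trichotomy s t with hst | rfl | hst
    · simp [hst, hst.not_gt]
    · simp [h]
    · simp [hst, hst.not_gt]
  have h2 : (Finset.univ.filter fun q : Fin n × Fin n => q.2 < q.1 ∧ mult P q.1 q.2 = 2).card =
      (Finset.univ.filter fun q : Fin n × Fin n => q.1 < q.2 ∧ mult P q.1 q.2 = 2).card := by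
    refine Finset.card_bij' (fun q _ => q.swap) (fun q _ => q.swap) ?_ ?_ ?_ ?_ <;>
      simp +contextual [mult_comm P]
  rw [h1, Finset.card_union_of_disjoint, h2, edgesWithMult]
  · omega
  · rw [Finset.disjoint_filter]
    rintro q - ⟨h3, -⟩ ⟨h4, -⟩
    exact lt_asymm h3 h4

theorem mem_SD_iff {P : Pairing n d} {i : ℕ} :
    P ∈ SD n d i ↔ (∀ s, mult P s s = 0) ∧ (∀ s t, mult P s t ≤ 2) ∧
      (doubles P).card = 2 * i := by
  simp only [SD, Set.mem_ofPred_eq, numLoops_eq_zero_iff]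
  constructor
  · rintro ⟨h1, h2, h3⟩
    refine ⟨h1, fun s t => ?_, by rw [card_doubles P h1, h3]⟩
    by_cases hst : s = t
    · subst hst; simp [h1]
    · exact h2 s t hst
  · rintro ⟨h1, h2, h3⟩
    refine ⟨h1, fun s t _ => h2 s t, ?_⟩
    rw [card_doubles P h1] at h3
    omega

theorem MultMove.card_doubles {P Q : Pairing n d} {u v x y z w : Fin n}
    (h : MultMove (mult P) (mult Q) u v x y z w) (hd : Distinct6 u v x y z w)
    (huv : mult P u v = 2) (hxy : mult P x y = 1) (hzw : mult P z w = 1)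
    (hux : mult P u x = 0) (huz : mult P u z = 0) (hvy : mult P v y = 0)
    (hvw : mult P v w = 0) :
    (doubles P).card = (doubles Q).card + 2 := by
  have huv' : u ≠ v := by
    simp only [Distinct6, List.nodup_cons, List.mem_cons, not_or] at hd
    exact hd.1.1
  have key := h.eq_or hd (mult_comm P) (mult_comm Q) huv hxy hzw hux huz hvy hvw
  have h1 : doubles P = insert (u, v) (insert (v, u) (doubles Q)) := by
    ext ⟨s, t⟩
    simp only [doubles, Finset.mem_filter, Finset.mem_univ, true_and, Finset.mem_insert]
    rcases key s t with hk | hk | hk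
    · simp only [hk.2.1, true_iff]; tauto
    · simp only [hk.1.1, hk.1.2, false_or]; omega
    · simp only [hk.1.1, hk.1.2, false_or, hk.2]
  have hq : mult Q u v = 0 := by
    have := (h.values hd).1
    omega
  rw [h1, Finset.card_insert_of_notMem, Finset.card_insert_of_notMem]
  · simp [doubles, mult_comm Q v u, hq]
  · simp [doubles, hq, huv']

theorem MultMove.mem_SD_iff {P Q : Pairing n d} {u v x y z w : Fin n} {i : ℕ}
    (h : MultMove (mult P) (mult Q) u v x y z w) (hd : Distinct6 u v x y z w)
    (huv : mult P u v = 2) (hxy : mult P x y = 1) (hzw : mult P z w = 1)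
    (hux : mult P u x = 0) (huz : mult P u z = 0) (hvy : mult P v y = 0)
    (hvw : mult P v w = 0) :
    P ∈ SD n d (i + 1) ↔ Q ∈ SD n d i := by
  have huv' : u ≠ v := by
    simp only [Distinct6, List.nodup_cons, List.mem_cons, not_or] at hd
    exact hd.1.1
  have key := h.eq_or hd (mult_comm P) (mult_comm Q) huv hxy hzw hux huz hvy hvw
  have hc := h.card_doubles hd huv hxy hzw hux huz hvy hvw
  rw [Reg.mem_SD_iff, Reg.mem_SD_iff]
  have hdiag : ∀ s, mult P s s = mult Q s s := by
    intro s
    rcases key s s with hk | hk | hk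
    · obtain ⟨h1 | h1, -⟩ := hk <;> simp only [Prod.mk.injEq] at h1 <;> grind
    · exact absurd rfl hk.2.1
    · exact hk.2
  have hle : ∀ s t, mult P s t ≤ 2 ↔ mult Q s t ≤ 2 := by
    intro s t
    rcases key s t with hk | hk | hk <;> omega
  simp only [hdiag, hle, hc]
  constructor <;> rintro ⟨h1, h2, h3⟩ <;> exact ⟨h1, h2, by omega⟩

/-- The points `a, b` and their partners form a double edge which the switching given by
`c, e` removes without creating another one. -/
def DownMove (P : Pairing n d) (a b c e : Point n d) : Prop :=
  a ≠ b ∧ b.1 = a.1 ∧ (P.f b).1 = (P.f a).1 ∧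
  Distinct6 a.1 (P.f a).1 c.1 (P.f c).1 e.1 (P.f e).1 ∧
  mult P a.1 (P.f a).1 = 2 ∧ mult P c.1 (P.f c).1 = 1 ∧ mult P e.1 (P.f e).1 = 1 ∧
  mult P a.1 c.1 = 0 ∧ mult P a.1 e.1 = 0 ∧
  mult P (P.f a).1 (P.f c).1 = 0 ∧ mult P (P.f a).1 (P.f e).1 = 0

/-- The switching given by `a, b, c, e` creates a double edge joining the bin of `a, b` to
that of `c, e` and affects no other double edge. -/
def UpMove (P : Pairing n d) (a b c e : Point n d) : Prop :=
  a ≠ b ∧ b.1 = a.1 ∧ c ≠ e ∧ e.1 = c.1 ∧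
  Distinct6 a.1 c.1 (P.f a).1 (P.f c).1 (P.f b).1 (P.f e).1 ∧
  mult P a.1 c.1 = 0 ∧ mult P (P.f a).1 (P.f c).1 = 0 ∧ mult P (P.f b).1 (P.f e).1 = 0 ∧
  mult P a.1 (P.f a).1 = 1 ∧ mult P a.1 (P.f b).1 = 1 ∧
  mult P c.1 (P.f c).1 = 1 ∧ mult P c.1 (P.f e).1 = 1

theorem DownMove.nodup {P : Pairing n d} {a b c e : Point n d} (h : DownMove P a b c e) :
    (switchPoints P a b c e).Nodup := by
  obtain ⟨hab, hb, hfb, hd, -⟩ := h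
  simp only [Distinct6, switchPoints, List.nodup_cons, List.mem_cons, not_or, List.not_mem_nil,
    not_false_eq_true, List.nodup_nil, and_true] at hd ⊢
  refine ⟨⟨?_, ?_, ?_, ?_, ?_, ?_, ?_⟩, ⟨?_, ?_, ?_, ?_, ?_, ?_⟩, ⟨?_, ?_, ?_, ?_, ?_⟩,
    ⟨?_, ?_, ?_, ?_⟩, ⟨?_, ?_, ?_⟩, ⟨?_, ?_⟩, ?_⟩ <;> intro hpq <;>
    have hbin := congrArg Prod.fst hpq <;> have hf := congrArg P.f hpq <;>
    (try simp only [P.invol] at hf) <;> grind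

theorem UpMove.nodup {P : Pairing n d} {a b c e : Point n d} (h : UpMove P a b c e) :
    (switchPoints P a b c e).Nodup := by
  obtain ⟨hab, hb, hce, he, hd, -⟩ := h
  simp only [Distinct6, switchPoints, List.nodup_cons, List.mem_cons, not_or, List.not_mem_nil,
    not_false_eq_true, List.nodup_nil, and_true] at hd ⊢
  refine ⟨⟨?_, ?_, ?_, ?_, ?_, ?_, ?_⟩, ⟨?_, ?_, ?_, ?_, ?_, ?_⟩, ⟨?_, ?_, ?_, ?_, ?_⟩,
    ⟨?_, ?_, ?_, ?_⟩, ⟨?_, ?_, ?_⟩, ⟨?_, ?_⟩, ?_⟩ <;> intro hpq <;>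
    have hbin := congrArg Prod.fst hpq <;> have hf := congrArg P.f hpq <;>
    (try simp only [P.invol] at hf) <;> grind

theorem DownMove.multMove {P : Pairing n d} {a b c e : Point n d} (h : DownMove P a b c e) :
    MultMove (mult P) (mult (switched P a b c e))
      a.1 (P.f a).1 c.1 (P.f c).1 e.1 (P.f e).1 := by
  intro s t
  have H := mult_switched h.nodup s t
  rw [h.2.1, h.2.2.1] at H
  omega

theorem UpMove.multMove {P : Pairing n d} {a b c e : Point n d} (h : UpMove P a b c e) :
    MultMove (mult (switched P a b c e)) (mult P)
      a.1 c.1 (P.f a).1 (P.f c).1 (P.f b).1 (P.f e).1 := by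
  intro s t
  have H := mult_switched h.nodup s t
  rw [h.2.1, h.2.2.2.1] at H
  omega

theorem DownMove.switched_mem {P : Pairing n d} {a b c e : Point n d} (h : DownMove P a b c e)
    {i : ℕ} (hP : P ∈ SD n d (i + 1)) : switched P a b c e ∈ SD n d i := by
  obtain ⟨-, -, -, hd, h1, h2, h3, h4, h5, h6, h7⟩ := id h
  exact (h.multMove.mem_SD_iff hd h1 h2 h3 h4 h5 h6 h7).1 hP

theorem UpMove.switched_mem {P : Pairing n d} {a b c e : Point n d} (h : UpMove P a b c e)
    {i : ℕ} (hP : P ∈ SD n d i) : switched P a b c e ∈ SD n d (i + 1) := by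
  obtain ⟨-, hb, -, he, hd, h1, h2, h3, h4, h5, h6, h7⟩ := id h
  have hv := h.multMove.values hd
  exact (h.multMove.mem_SD_iff hd (by omega) (by omega) (by omega) (by omega) (by omega)
    (by omega) (by omega)).2 hP

theorem UpMove.downMove {P : Pairing n d} {a b c e : Point n d} (h : UpMove P a b c e) :
    DownMove (switched P a b c e) a b (P.f a) (P.f b) := by
  obtain ⟨g1, g2, g3, g4, g5, g6, g7, g8⟩ := switched_values h.nodup
  have hm := h.multMove
  obtain ⟨hab, hb, -, he, hd, h1, h2, h3, h4, h5, h6, h7⟩ := h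
  have hv := hm.values hd
  rw [DownMove, g1, g2, g3, g4]
  exact ⟨hab, hb, he, hd, by omega, by omega, by omega, by omega, by omega, by omega, by omega⟩

theorem card_mul_le_card_of_fibers {α β : Type*} [DecidableEq α] [DecidableEq β] [Fintype β]
    (G : Finset α) (S : Finset (α × β)) (K : ℕ)
    (h : ∀ c ∈ G, K ≤ (Finset.univ.filter fun e => (c, e) ∈ S).card) : G.card * K ≤ S.card := by
  calc G.card * K = ∑ c ∈ G, K := by simp
    _ ≤ ∑ c ∈ G, (Finset.univ.filter fun e => (c, e) ∈ S).card := Finset.sum_le_sum h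
    _ = (G.sigma fun c => Finset.univ.filter fun e => (c, e) ∈ S).card :=
        (Finset.card_sigma _ _).symm
    _ ≤ S.card := by
        refine Finset.card_le_card_of_injOn (fun x => (x.1, x.2)) ?_ ?_
        · rintro ⟨c, e⟩ hx
          simpa using (Finset.mem_sigma.1 hx).2
        · rintro ⟨c, e⟩ - ⟨c', e'⟩ - hx
          simp only [Prod.mk.injEq] at hx
          obtain ⟨rfl, rfl⟩ := hx
          rfl

theorem card_filter_or_le {α : Type*} [Fintype α] {p q : α → Prop} {k l : ℕ}
    {_ : DecidablePred p} [DecidablePred q] {_ : DecidablePred fun x => p x ∨ q x}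
    (hp : (Finset.univ.filter p).card ≤ k) (hq : (Finset.univ.filter q).card ≤ l) :
    (Finset.univ.filter fun x => p x ∨ q x).card ≤ k + l := by
  classical
  refine le_trans (le_of_eq ?_)
    ((Finset.card_union_le (Finset.univ.filter p) (Finset.univ.filter q)).trans (add_le_add hp hq))
  congr 1
  ext x
  simp

theorem card_bin (u : Fin n) : (Finset.univ.filter fun x : Point n d => x.1 = u).card = d := by
  have : (Finset.univ.filter fun x : Point n d => x.1 = u) =
      Finset.univ.image fun j : Fin d => (u, j) := by
    ext ⟨s, j⟩
    simp [eq_comm]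
  rw [this, Finset.card_image_of_injective _ (Prod.mk_right_injective u)]
  simp

theorem card_filter_partner (P : Pairing n d) (p : Point n d → Prop) [DecidablePred p] :
    (Finset.univ.filter fun x => p (P.f x)).card = (Finset.univ.filter p).card := by
  refine Finset.card_bij' (fun x _ => P.f x) (fun x _ => P.f x) ?_ ?_ ?_ ?_ <;>
    simp +contextual [P.invol]

theorem one_le_mult (P : Pairing n d) (x : Point n d) : 1 ≤ mult P x.1 (P.f x).1 :=
  Finset.card_pos.2 ⟨x, by simp⟩

theorem card_adjacent_le (P : Pairing n d) (u : Fin n) :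
    (Finset.univ.filter fun x : Point n d => mult P u x.1 ≠ 0).card ≤ d * d := by
  have h : (Finset.univ.filter fun x : Point n d => mult P u x.1 ≠ 0) ⊆
      (Finset.univ.filter fun y : Point n d => y.1 = u).biUnion fun y =>
        Finset.univ.filter fun x : Point n d => x.1 = (P.f y).1 := by
    intro x hx
    rw [Finset.mem_filter, mult, Finset.card_ne_zero] at hx
    obtain ⟨-, y, hy⟩ := hx
    rw [Finset.mem_filter] at hy
    simp only [Finset.mem_biUnion, Finset.mem_filter, Finset.mem_univ, true_and]
    exact ⟨y, hy.2.1, hy.2.2.symm⟩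
  refine (Finset.card_le_card h).trans (Finset.card_biUnion_le.trans ?_)
  simp [card_bin]

theorem card_double_points_le {P : Pairing n d} {i : ℕ} (hP : P ∈ SD n d i) :
    (Finset.univ.filter fun x : Point n d => mult P x.1 (P.f x).1 = 2).card ≤ 4 * i := by
  have h := (mem_SD_iff.1 hP).2.2
  have := Finset.card_le_mul_card_image_of_maps_to
    (s := Finset.univ.filter fun x : Point n d => mult P x.1 (P.f x).1 = 2)
    (t := doubles P) (f := fun x => (x.1, (P.f x).1)) (by simp [doubles]) 2 ?_
  · omega
  · rintro ⟨s, t⟩ hst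
    simp only [doubles, Finset.mem_filter, Finset.mem_univ, true_and] at hst
    rw [← hst]
    refine Finset.card_le_card fun x hx => ?_
    simp only [Finset.mem_filter, Finset.mem_univ, true_and, Prod.mk.injEq] at hx ⊢
    exact hx.2

theorem card_partner_bin (P : Pairing n d) (u : Fin n) :
    (Finset.univ.filter fun x : Point n d => (P.f x).1 = u).card = d := by
  rw [card_filter_partner P (fun x => x.1 = u), card_bin]

theorem card_partner_adjacent_le (P : Pairing n d) (u : Fin n) :
    (Finset.univ.filter fun x : Point n d => mult P u (P.f x).1 ≠ 0).card ≤ d * d := by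
  rw [card_filter_partner P (fun x => mult P u x.1 ≠ 0)]
  exact card_adjacent_le P u

theorem le_card_downMove {P : Pairing n d} {i : ℕ} (hP : P ∈ SD n d i) {a b : Point n d}
    (hab : a ≠ b) (hb : b.1 = a.1) (hfb : (P.f b).1 = (P.f a).1)
    [DecidablePred fun t : Point n d × Point n d => DownMove P a b t.1 t.2] :
    (n * d - (8 * d + 4 * i + 2 * (d * d))) * (n * d - (8 * d + 4 * i + 2 * (d * d))) ≤
      (Finset.univ.filter fun t : Point n d × Point n d => DownMove P a b t.1 t.2).card := by
  obtain ⟨h0, h2, -⟩ := mem_SD_iff.1 hP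
  have hloop := (mult_self_eq_zero_iff P).1 h0
  have habm : mult P a.1 (P.f a).1 = 2 := by
    refine le_antisymm (h2 _ _) ?_
    have : ({a, b} : Finset (Point n d)) ⊆ Finset.univ.filter
        fun x : Point n d => x.1 = a.1 ∧ (P.f x).1 = (P.f a).1 := by
      intro x hx
      simp only [Finset.mem_insert, Finset.mem_singleton] at hx
      rcases hx with rfl | rfl <;> simp [hb, hfb]
    have h3 := Finset.card_le_card this
    rwa [Finset.card_pair hab] at h3
  let bad : Point n d → Prop := fun x => x.1 = a.1 ∨ x.1 = (P.f a).1 ∨ (P.f x).1 = a.1 ∨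
    (P.f x).1 = (P.f a).1 ∨ mult P x.1 (P.f x).1 = 2 ∨ mult P a.1 x.1 ≠ 0 ∨
    mult P (P.f a).1 (P.f x).1 ≠ 0
  have hbaddec : DecidablePred bad := fun x => by unfold bad; infer_instance
  have hbad : (Finset.univ.filter bad).card ≤ 4 * d + 4 * i + 2 * (d * d) := by
    refine (card_filter_or_le (card_bin _).le (card_filter_or_le (card_bin _).le
      (card_filter_or_le (card_partner_bin _ _).le (card_filter_or_le (card_partner_bin _ _).le
      (card_filter_or_le (card_double_points_le hP) (card_filter_or_le (card_adjacent_le _ _)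
      (card_partner_adjacent_le _ _))))))).trans ?_
    omega
  have hgood := Finset.card_filter_add_card_filter_not (s := Finset.univ) bad
  have huniv : (Finset.univ : Finset (Point n d)).card = n * d := by simp
  refine le_trans (Nat.mul_le_mul_right _ (?_ : _ ≤ (Finset.univ.filter fun x => ¬ bad x).card))
    (card_mul_le_card_of_fibers _ _ _ ?_)
  · omega
  intro c hc
  simp only [Finset.mem_filter, Finset.mem_univ, true_and] at hc ⊢
  let bad' : Point n d → Prop := fun x => x.1 = c.1 ∨ x.1 = (P.f c).1 ∨ (P.f x).1 = c.1 ∨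
    (P.f x).1 = (P.f c).1
  have hbaddec' : DecidablePred bad' := fun x => by unfold bad'; infer_instance
  have hbad' : (Finset.univ.filter bad').card ≤ 4 * d := by
    refine (card_filter_or_le (card_bin _).le (card_filter_or_le (card_bin _).le
      (card_filter_or_le (card_partner_bin _ _).le (card_partner_bin _ _).le))).trans ?_
    omega
  have hor : (Finset.univ.filter fun x => bad x ∨ bad' x).card ≤ _ :=
    card_filter_or_le hbad hbad'
  have hnot := Finset.card_filter_add_card_filter_not (s := Finset.univ)
    (fun x => bad x ∨ bad' x)
  have hsub : (Finset.univ.filter fun x => ¬ (bad x ∨ bad' x)) ⊆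
      Finset.univ.filter fun e => (c, e) ∈ Finset.univ.filter
        fun t : Point n d × Point n d => DownMove P a b t.1 t.2 := by
    intro e he
    simp only [Finset.mem_filter, Finset.mem_univ, true_and, bad, bad', not_or] at he hc ⊢
    have m1 := one_le_mult P c
    have m2 := one_le_mult P e
    have m3 := h2 c.1 (P.f c).1
    have m4 := h2 e.1 (P.f e).1
    have l1 := hloop a
    have l2 := hloop c
    have l3 := hloop e
    refine ⟨hab, hb, hfb, ?_, habm, by omega, by omega, by tauto, by tauto, by tauto, by tauto⟩
    simp only [Distinct6, List.nodup_cons, List.mem_cons, not_or, List.not_mem_nil,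
      not_false_eq_true, List.nodup_nil, and_true, eq_comm] at *
    tauto
  have := Finset.card_le_card hsub
  omega

theorem card_same_bin (c : Point n d) :
    (Finset.univ.filter fun e : Point n d => c ≠ e ∧ e.1 = c.1).card = d - 1 := by
  have : (Finset.univ.filter fun e : Point n d => c ≠ e ∧ e.1 = c.1) =
      (Finset.univ.filter fun e : Point n d => e.1 = c.1).erase c := by
    ext e
    simp [eq_comm]
  rw [this, Finset.card_erase_of_mem (by simp), card_bin]

theorem le_card_same_bin_avoiding (B : Finset (Point n d)) :
    (n * d - 2 * B.card) * (d - 1) ≤ (Finset.univ.filter fun t : Point n d × Point n d =>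
      (t.1 ≠ t.2 ∧ t.2.1 = t.1.1) ∧ t.1 ∉ B ∧ t.2 ∉ B).card := by
  have h1 : n * d * (d - 1) ≤ (Finset.univ.filter fun t : Point n d × Point n d =>
      t.1 ≠ t.2 ∧ t.2.1 = t.1.1).card := by
    have := card_mul_le_card_of_fibers Finset.univ (Finset.univ.filter
      fun t : Point n d × Point n d => t.1 ≠ t.2 ∧ t.2.1 = t.1.1) (d - 1) (by
        intro c _
        simp only [Finset.mem_filter, Finset.mem_univ, true_and, card_same_bin, le_refl])
    simpa using this
  have h2 : (Finset.univ.filter fun t : Point n d × Point n d =>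
      (t.1 ≠ t.2 ∧ t.2.1 = t.1.1) ∧ t.1 ∈ B).card ≤ (d - 1) * B.card := by
    refine Finset.card_le_mul_card_image_of_maps_to (f := Prod.fst) (by simp) _ fun c _ => ?_
    rw [← card_same_bin c]
    refine Finset.card_le_card_of_injOn Prod.snd ?_ ?_
    · rintro ⟨x, y⟩ hx
      simp only [Finset.coe_filter, Finset.mem_filter, Finset.mem_univ, true_and,
        Set.mem_ofPred_eq] at hx ⊢
      obtain ⟨⟨h, -⟩, rfl⟩ := hx
      exact h
    · rintro ⟨x, y⟩ hx ⟨x', y'⟩ hx' hxy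
      simp only [Finset.coe_filter, Finset.mem_filter, Finset.mem_univ, true_and,
        Set.mem_ofPred_eq] at hx hx' hxy
      rw [hx.2, hx'.2, hxy]
  have h3 : (Finset.univ.filter fun t : Point n d × Point n d =>
      (t.1 ≠ t.2 ∧ t.2.1 = t.1.1) ∧ t.2 ∈ B).card = (Finset.univ.filter
      fun t : Point n d × Point n d => (t.1 ≠ t.2 ∧ t.2.1 = t.1.1) ∧ t.1 ∈ B).card := by
    refine Finset.card_bij' (fun t _ => t.swap) (fun t _ => t.swap) ?_ ?_ ?_ ?_ <;>
      simp +contextual [eq_comm]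
  have h4 : (Finset.univ.filter fun t : Point n d × Point n d =>
      t.1 ≠ t.2 ∧ t.2.1 = t.1.1) ⊆ ((Finset.univ.filter fun t : Point n d × Point n d =>
      (t.1 ≠ t.2 ∧ t.2.1 = t.1.1) ∧ t.1 ∉ B ∧ t.2 ∉ B) ∪ (Finset.univ.filter
      fun t : Point n d × Point n d => (t.1 ≠ t.2 ∧ t.2.1 = t.1.1) ∧ t.1 ∈ B)) ∪
      (Finset.univ.filter fun t : Point n d × Point n d =>
      (t.1 ≠ t.2 ∧ t.2.1 = t.1.1) ∧ t.2 ∈ B) := by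
    intro t ht
    simp only [Finset.mem_filter, Finset.mem_univ, true_and, Finset.mem_union] at ht ⊢
    tauto
  have h5 := (Finset.card_le_card h4).trans (Finset.card_union_le _ _)
  have h6 := Finset.card_union_le (Finset.univ.filter fun t : Point n d × Point n d =>
      (t.1 ≠ t.2 ∧ t.2.1 = t.1.1) ∧ t.1 ∉ B ∧ t.2 ∉ B) (Finset.univ.filter
      fun t : Point n d × Point n d => (t.1 ≠ t.2 ∧ t.2.1 = t.1.1) ∧ t.1 ∈ B)
  rw [Nat.sub_mul, show 2 * B.card * (d - 1) = 2 * ((d - 1) * B.card) by ring]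
  omega

theorem le_card_upMove {P : Pairing n d} {i : ℕ} (hP : P ∈ SD n d i)
    [DecidablePred fun t : (Point n d × Point n d) × (Point n d × Point n d) =>
      UpMove P t.1.1 t.1.2 t.2.1 t.2.2] :
    ((n * d - 2 * (4 * i)) * (d - 1)) * ((n * d - 2 * (4 * i + 5 * d + 4 * (d * d))) * (d - 1)) ≤
      (Finset.univ.filter fun t : (Point n d × Point n d) × (Point n d × Point n d) =>
        UpMove P t.1.1 t.1.2 t.2.1 t.2.2).card := by
  obtain ⟨h0, h2, -⟩ := mem_SD_iff.1 hP
  have hloop := (mult_self_eq_zero_iff P).1 h0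
  have hdbl := card_double_points_le hP
  refine le_trans (Nat.mul_le_mul_right _ ((Nat.mul_le_mul_right _ ?_).trans
    (le_card_same_bin_avoiding
      (Finset.univ.filter fun x : Point n d => mult P x.1 (P.f x).1 = 2))))
    (card_mul_le_card_of_fibers _ _ _ ?_)
  · omega
  rintro ⟨a, b⟩ hab
  simp only [Finset.mem_filter, Finset.mem_univ, true_and] at hab ⊢
  obtain ⟨⟨hne, hb⟩, ha2, hb2⟩ := hab
  let bad : Point n d → Prop := fun x => mult P x.1 (P.f x).1 = 2 ∨ x.1 = a.1 ∨
    x.1 = (P.f a).1 ∨ x.1 = (P.f b).1 ∨ (P.f x).1 = (P.f a).1 ∨ (P.f x).1 = (P.f b).1 ∨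
    mult P a.1 x.1 ≠ 0 ∨ mult P (P.f a).1 (P.f x).1 ≠ 0 ∨ mult P (P.f b).1 (P.f x).1 ≠ 0
  have hbaddec : DecidablePred bad := fun x => by unfold bad; infer_instance
  have hbad : (Finset.univ.filter bad).card ≤ 4 * i + 5 * d + 4 * (d * d) := by
    refine (card_filter_or_le hdbl (card_filter_or_le (card_bin _).le
      (card_filter_or_le (card_bin _).le (card_filter_or_le (card_bin _).le
      (card_filter_or_le (card_partner_bin _ _).le (card_filter_or_le (card_partner_bin _ _).le
      (card_filter_or_le (card_adjacent_le _ _) (card_filter_or_le (card_partner_adjacent_le _ _)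
      (card_partner_adjacent_le _ _))))))))).trans ?_
    omega
  refine (Nat.mul_le_mul_right _ ?_).trans
    ((le_card_same_bin_avoiding (Finset.univ.filter bad)).trans (Finset.card_le_card ?_))
  · omega
  rintro ⟨c, e⟩ hce
  simp only [Finset.mem_filter, Finset.mem_univ, true_and] at hce ⊢
  obtain ⟨⟨hce, he⟩, hc', he'⟩ := hce
  simp only [bad, not_or, not_not] at hc' he'
  have one_of : ∀ x, ¬ mult P x.1 (P.f x).1 = 2 → mult P x.1 (P.f x).1 = 1 := fun x hx => by
    have m1 := one_le_mult P x
    have m2 := h2 x.1 (P.f x).1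
    omega
  have two_le : ∀ x y : Point n d, x ≠ y → y.1 = x.1 → mult P x.1 (P.f x).1 = 1 →
      (P.f x).1 ≠ (P.f y).1 := fun x y hxy hy hx hxy' => by
    rw [mult, Finset.card_eq_one] at hx
    obtain ⟨z, hz⟩ := hx
    have hx1 : x ∈ ({z} : Finset (Point n d)) := by rw [← hz]; simp
    have hy1 : y ∈ ({z} : Finset (Point n d)) := by rw [← hz]; simp [hy, hxy']
    rw [Finset.mem_singleton] at hx1 hy1
    exact hxy (hx1.trans hy1.symm)
  have a1 := one_of a ha2
  have b1 := one_of b hb2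
  have c1 := one_of c hc'.1
  have e1 := one_of e he'.1
  have fab := two_le a b hne hb a1
  have fce := two_le c e hce he c1
  have aneq : a.1 ≠ (P.f c).1 := fun h => by
    have := hc'.2.2.2.2.2.2.1
    rw [mult_comm, h, c1] at this
    omega
  have aneq' : a.1 ≠ (P.f e).1 := fun h => by
    have := he'.2.2.2.2.2.2.1
    rw [mult_comm, h, e1] at this
    omega
  have l1 := hloop a
  have l2 := hloop b
  have l3 := hloop c
  have l4 := hloop e
  refine ⟨hne, hb, hce, he, ?_, by tauto, by tauto, by tauto, a1, hb ▸ b1, c1, he ▸ e1⟩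
  rw [hb] at l2
  rw [he] at l4
  simp only [Distinct6, List.nodup_cons, List.mem_cons, not_or, List.not_mem_nil,
    not_false_eq_true, List.nodup_nil, and_true]
  simp only [he] at hc' he'
  refine ⟨⟨Ne.symm hc'.2.1, l1.symm, aneq, l2.symm, aneq'⟩,
    ⟨hc'.2.2.1, l3.symm, hc'.2.2.2.1, l4.symm⟩,
    ⟨Ne.symm hc'.2.2.2.2.1, fab, Ne.symm he'.2.2.2.2.1⟩,
    ⟨hc'.2.2.2.2.2.1, fce⟩, Ne.symm he'.2.2.2.2.2.1⟩

/-- Triples consisting of two points `a, b` which together with their partners form a double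
edge, and a bin joined to the bin of `a` by another double edge. -/
def sharedTriples (P : Pairing n d) : Finset (Point n d × Point n d × Fin n) :=
  Finset.univ.filter fun t => t.1 ≠ t.2.1 ∧ t.2.1.1 = t.1.1 ∧ (P.f t.2.1).1 = (P.f t.1).1 ∧
    t.2.2 ≠ (P.f t.1).1 ∧ mult P t.1.1 t.2.2 = 2

theorem exists_points_of_mult_eq_two {P : Pairing n d} {u v : Fin n} (h : mult P u v = 2) :
    ∃ a b : Point n d, a ≠ b ∧ a.1 = u ∧ b.1 = u ∧ (P.f a).1 = v ∧ (P.f b).1 = v := by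
  rw [mult, Finset.card_eq_two] at h
  obtain ⟨a, b, hab, h⟩ := h
  have ha : a ∈ ({a, b} : Finset (Point n d)) := by simp
  have hb : b ∈ ({a, b} : Finset (Point n d)) := by simp
  rw [← h, Finset.mem_filter] at ha hb
  exact ⟨a, b, hab, ha.2.1, hb.2.1, ha.2.2, hb.2.2⟩

theorem doubleSharedOrdered_le (P : Pairing n d) :
    doubleSharedOrdered P ≤ (sharedTriples P).card := by
  let sort : Fin n → Fin n → Fin n × Fin n := fun s t => (min s t, max s t)
  refine Finset.card_le_card_of_surjOn
    (fun t => (sort t.1.1 (P.f t.1).1, sort t.1.1 t.2.2)) ?_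
  rintro ⟨⟨p, q⟩, ⟨r, s⟩⟩ h
  simp only [Finset.coe_filter, Finset.mem_univ, true_and, Set.mem_ofPred_eq, ne_eq,
    Prod.mk.injEq] at h
  obtain ⟨hpq, hrs, h1, h2, hne, hsh⟩ := h
  have key : ∃ u v w, v ≠ w ∧ mult P u v = 2 ∧ mult P u w = 2 ∧ sort u v = (p, q) ∧
      sort u w = (r, s) := by
    have h1' := h1
    have h2' := h2
    rw [mult_comm] at h1' h2'
    rcases hsh with rfl | rfl | rfl | rfl
    · exact ⟨p, q, s, by grind, h1, h2, by simp [sort, hpq.le], by simp [sort, hrs.le]⟩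
    · exact ⟨p, q, r, by grind, h1, h2', by simp [sort, hpq.le], by simp [sort, hrs.le]⟩
    · exact ⟨q, p, s, by grind, h1', h2, by simp [sort, hpq.le], by simp [sort, hrs.le]⟩
    · exact ⟨q, p, r, by grind, h1', h2', by simp [sort, hpq.le], by simp [sort, hrs.le]⟩
  obtain ⟨u, v, w, hvw, huv, huw, e1, e2⟩ := key
  obtain ⟨a, b, hab, rfl, hb, rfl, hfb⟩ := exists_points_of_mult_eq_two huv
  refine ⟨(a, b, w), ?_, Prod.ext e1 e2⟩
  simp only [sharedTriples, Finset.coe_filter, Finset.mem_univ, true_and, Set.mem_ofPred_eq]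
  exact ⟨hab, hb, hfb, hvw.symm, huw⟩

/-- The set `SD n d i` as a finset. -/
noncomputable def SDFinset (n d i : ℕ) : Finset (Pairing n d) := (Set.toFinite (SD n d i)).toFinset

theorem mem_SDFinset {P : Pairing n d} {i : ℕ} : P ∈ SDFinset n d i ↔ P ∈ SD n d i := by
  simp [SDFinset]

theorem sum_card_sharedTriples_mul_le (n d j : ℕ) :
    (∑ P ∈ SDFinset n d (j + 1), (sharedTriples P).card) *
        ((n * d - (8 * d + 4 * (j + 1) + 2 * (d * d))) *
          (n * d - (8 * d + 4 * (j + 1) + 2 * (d * d)))) ≤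
      (SDFinset n d j).card * (2 * j * (d * (d * (n * d * d)))) := by
  classical
  set K := (n * d - (8 * d + 4 * (j + 1) + 2 * (d * d))) *
    (n * d - (8 * d + 4 * (j + 1) + 2 * (d * d)))
  let D : Pairing n d → Finset ((Point n d × Point n d × Fin n) × (Point n d × Point n d)) :=
    fun P => Finset.univ.filter fun t => t.1 ∈ sharedTriples P ∧
      DownMove P t.1.1 t.1.2.1 t.2.1 t.2.2
  let T : Pairing n d → Finset ((Fin n × Fin n) × (Fin d × (Fin d × (Point n d × Fin d)))) :=
    fun Q => doubles Q ×ˢ Finset.univ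
  calc (∑ P ∈ SDFinset n d (j + 1), (sharedTriples P).card) * K
      = ∑ P ∈ SDFinset n d (j + 1), (sharedTriples P).card * K := Finset.sum_mul _ _ _
    _ ≤ ∑ P ∈ SDFinset n d (j + 1), (D P).card := by
        refine Finset.sum_le_sum fun P hP => card_mul_le_card_of_fibers _ _ _ ?_
        rintro ⟨a, b, w⟩ ht
        have ht' := ht
        simp only [sharedTriples, Finset.mem_filter, Finset.mem_univ, true_and] at ht'
        refine (le_card_downMove (mem_SDFinset.1 hP) ht'.1 ht'.2.1 ht'.2.2.1).trans ?_
        refine Finset.card_le_card fun t h => ?_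
        simp only [D, Finset.mem_filter, Finset.mem_univ, true_and] at h ⊢
        exact ⟨ht, h⟩
    _ = ((SDFinset n d (j + 1)).sigma D).card := (Finset.card_sigma _ _).symm
    _ ≤ ((SDFinset n d j).sigma T).card := by
        refine Finset.card_le_card_of_injOn
          (fun x => ⟨switched x.1 x.2.1.1 x.2.1.2.1 x.2.2.1 x.2.2.2,
            ((x.2.1.1.1, x.2.1.2.2), x.2.1.1.2, x.2.1.2.1.2, x.1.f x.2.1.1,
              (x.1.f x.2.1.2.1).2)⟩) ?_ ?_
        · rintro ⟨P, ⟨a, b, w⟩, c, e⟩ hx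
          simp only [D, T, Finset.coe_sigma, Set.mem_sigma_iff, Finset.mem_coe, mem_SDFinset,
            Finset.mem_filter, Finset.mem_univ, true_and, Finset.mem_product, and_true,
            sharedTriples, doubles] at hx ⊢
          obtain ⟨hP, ⟨-, -, -, hw, hm⟩, hdown⟩ := hx
          refine ⟨hdown.switched_mem hP, ?_⟩
          have hmm := hdown.multMove
          obtain ⟨-, -, -, hd, h1, h2, h3, h4, h5, h6, h7⟩ := hdown
          have hne : a.1 ≠ (P.f a).1 := by
            simp only [Distinct6, List.nodup_cons, List.mem_cons, not_or] at hd
            exact hd.1.1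
          rcases hmm.eq_or hd (mult_comm P) (mult_comm _) h1 h2 h3 h4 h5 h6 h7 a.1 w with
            h | h | h
          · simp only [Prod.mk.injEq] at h
            tauto
          · omega
          · rw [← h.2, hm]
        · refine Set.LeftInvOn.injOn (f₁' := fun y =>
            ⟨switched y.1 (y.2.1.1, y.2.2.1) (y.2.1.1, y.2.2.2.1) y.2.2.2.2.1
                (y.2.2.2.2.1.1, y.2.2.2.2.2),
              (((y.2.1.1, y.2.2.1), (y.2.1.1, y.2.2.2.1), y.2.1.2),
                (y.1.f (y.2.1.1, y.2.2.1), y.1.f (y.2.1.1, y.2.2.2.1)))⟩) ?_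
          rintro ⟨P, ⟨a, b, w⟩, c, e⟩ hx
          simp only [D, Finset.coe_sigma, Set.mem_sigma_iff, Finset.mem_coe, mem_SDFinset,
            Finset.mem_filter, Finset.mem_univ, true_and] at hx
          have hdown := hx.2.2
          have hb : (a.1, b.2) = b := by rw [← hdown.2.1]
          have hfb : ((P.f a).1, (P.f b).2) = P.f b := by rw [← hdown.2.2.1]
          have hv := switched_values hdown.nodup
          simp only [Prod.mk.eta, hb, hfb, hv, switched_switched hdown.nodup]
    _ = (SDFinset n d j).card * (2 * j * (d * (d * (n * d * d)))) := by
        rw [Finset.card_sigma, Finset.sum_const_nat]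
        intro Q hQ
        simp [T, (mem_SD_iff.1 (mem_SDFinset.1 hQ)).2.2]

theorem card_SDFinset_mul_le (n d j : ℕ) :
    (SDFinset n d j).card * (((n * d - 2 * (4 * j)) * (d - 1)) *
        ((n * d - 2 * (4 * j + 5 * d + 4 * (d * d))) * (d - 1))) ≤
      (SDFinset n d (j + 1)).card * (2 * (4 * (j + 1)) * (n * d * (n * d))) := by
  classical
  let U : Pairing n d → Finset ((Point n d × Point n d) × (Point n d × Point n d)) :=
    fun Q => Finset.univ.filter fun t => UpMove Q t.1.1 t.1.2 t.2.1 t.2.2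
  let R : Pairing n d → Finset (Point n d × Point n d) := fun P =>
    Finset.univ.filter fun t => mult P t.1.1 (P.f t.1).1 = 2 ∧ t.2.1 = t.1.1 ∧
      (P.f t.2).1 = (P.f t.1).1
  have hR : ∀ P ∈ SDFinset n d (j + 1), (R P).card ≤ 2 * (4 * (j + 1)) := by
    intro P hP
    refine (Finset.card_le_mul_card_image_of_maps_to
      (t := Finset.univ.filter fun x : Point n d => mult P x.1 (P.f x).1 = 2)
      (f := Prod.fst) ?_ 2 ?_).trans
      (Nat.mul_le_mul_left _ (card_double_points_le (mem_SDFinset.1 hP)))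
    · simp +contextual [R]
    · intro a ha
      simp only [Finset.mem_filter, Finset.mem_univ, true_and] at ha
      rw [← ha]
      refine Finset.card_le_card_of_injOn Prod.snd ?_ ?_
      · rintro ⟨x, y⟩ h
        simp only [R, Finset.coe_filter, Finset.mem_filter, Finset.mem_univ, true_and,
          Set.mem_ofPred_eq] at h ⊢
        obtain ⟨⟨-, h⟩, rfl⟩ := h
        exact h
      · rintro ⟨x, y⟩ h ⟨x', y'⟩ h' hy
        simp only [Finset.coe_filter, Set.mem_ofPred_eq] at h h' hy
        rw [h.2, h'.2, hy]
  calc _ = ∑ Q ∈ SDFinset n d j, (((n * d - 2 * (4 * j)) * (d - 1)) *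
        ((n * d - 2 * (4 * j + 5 * d + 4 * (d * d))) * (d - 1))) := by
        rw [Finset.sum_const, smul_eq_mul]
    _ ≤ ∑ Q ∈ SDFinset n d j, (U Q).card :=
        Finset.sum_le_sum fun Q hQ => le_card_upMove (mem_SDFinset.1 hQ)
    _ = ((SDFinset n d j).sigma U).card := (Finset.card_sigma _ _).symm
    _ ≤ ((SDFinset n d (j + 1)).sigma fun P =>
          R P ×ˢ (Finset.univ : Finset (Point n d × Point n d))).card := by
        refine Finset.card_le_card_of_injOn
          (fun x => ⟨switched x.1 x.2.1.1 x.2.1.2 x.2.2.1 x.2.2.2,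
            (x.2.1, (x.1.f x.2.1.1, x.1.f x.2.1.2))⟩) ?_ ?_
        · rintro ⟨Q, ⟨a, b⟩, c, e⟩ hx
          simp only [U, R, Finset.coe_sigma, Set.mem_sigma_iff, Finset.mem_coe, mem_SDFinset,
            Finset.mem_filter, Finset.mem_univ, true_and, Finset.mem_product, and_true] at hx ⊢
          obtain ⟨-, hb, hfb, -, h2, -⟩ := hx.2.downMove
          exact ⟨hx.2.switched_mem hx.1, h2, hb, hfb⟩
        · refine Set.LeftInvOn.injOn (f₁' := fun y =>
            ⟨switched y.1 y.2.1.1 y.2.1.2 y.2.2.1 y.2.2.2,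
              (y.2.1, (y.1.f y.2.1.1, y.1.f y.2.1.2))⟩) ?_
          rintro ⟨Q, ⟨a, b⟩, c, e⟩ hx
          simp only [U, Finset.coe_sigma, Set.mem_sigma_iff, Finset.mem_coe, mem_SDFinset,
            Finset.mem_filter, Finset.mem_univ, true_and] at hx
          have hv := switched_values hx.2.nodup
          simp only [hv, switched_switched hx.2.nodup]
    _ ≤ (SDFinset n d (j + 1)).card * (2 * (4 * (j + 1)) * (n * d * (n * d))) := by
        rw [Finset.card_sigma]
        refine Finset.sum_le_card_nsmul _ _ _ fun P hP => ?_
        rw [Finset.card_product]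
        simpa using Nat.mul_le_mul_right _ (hR P hP)

theorem sum_doubleSharedOrdered_mul_le {n d j : ℕ} (hd : 2 ≤ d)
    (h : 8 * (4 * (j + 1) + 8 * d + 4 * (d * d)) ≤ n * d) :
    (∑ P ∈ SDFinset n d (j + 1), doubleSharedOrdered P) * n ≤
      1024 * (j + 1) ^ 2 * (SDFinset n d (j + 1)).card := by
  have h1 := sum_card_sharedTriples_mul_le n d j
  have h2 := card_SDFinset_mul_le n d j
  have h3 : ∑ P ∈ SDFinset n d (j + 1), doubleSharedOrdered P ≤
      ∑ P ∈ SDFinset n d (j + 1), (sharedTriples P).card :=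
    Finset.sum_le_sum fun P _ => doubleSharedOrdered_le P
  set A := ∑ P ∈ SDFinset n d (j + 1), doubleSharedOrdered P
  set T := ∑ P ∈ SDFinset n d (j + 1), (sharedTriples P).card
  set s := (SDFinset n d j).card
  set s' := (SDFinset n d (j + 1)).card
  obtain ⟨m, rfl⟩ : ∃ m, d = m + 1 := ⟨d - 1, by omega⟩
  rw [Nat.add_sub_cancel] at h2
  set M := n * (m + 1) with hM
  have hMpos : 0 < M := by omega
  have k1 : M ≤ 2 * (M - (8 * (m + 1) + 4 * (j + 1) + 2 * ((m + 1) * (m + 1)))) := by omega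
  have k2 : M ≤ 2 * (M - 2 * (4 * j)) := by omega
  have k3 : M ≤ 2 * (M - 2 * (4 * j + 5 * (m + 1) + 4 * ((m + 1) * (m + 1)))) := by omega
  set x := M - (8 * (m + 1) + 4 * (j + 1) + 2 * ((m + 1) * (m + 1)))
  set y := M - 2 * (4 * j)
  set z := M - 2 * (4 * j + 5 * (m + 1) + 4 * ((m + 1) * (m + 1)))
  have g1 : A * n ≤ 8 * j * (m + 1) ^ 2 * s := by
    refine Nat.le_of_mul_le_mul_right (c := M * (m + 1)) ?_ (by positivity)
    calc A * n * (M * (m + 1)) = A * (M * M) := by rw [hM]; ring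
      _ ≤ T * (2 * x * (2 * x)) := by gcongr
      _ = 4 * (T * (x * x)) := by ring
      _ ≤ 4 * (s * (2 * j * ((m + 1) * ((m + 1) * (M * (m + 1)))))) := by gcongr
      _ = 8 * j * (m + 1) ^ 2 * s * (M * (m + 1)) := by ring
  have g2 : s * m ^ 2 ≤ 32 * (j + 1) * s' := by
    refine Nat.le_of_mul_le_mul_right (c := M * M) ?_ (by positivity)
    calc s * m ^ 2 * (M * M) ≤ s * m ^ 2 * (2 * y * (2 * z)) := by gcongr
      _ = 4 * (s * (y * m * (z * m))) := by ring
      _ ≤ 4 * (s' * (2 * (4 * (j + 1)) * (M * M))) := by gcongr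
      _ = 32 * (j + 1) * s' * (M * M) := by ring
  calc A * n ≤ 8 * j * (m + 1) ^ 2 * s := g1
    _ ≤ 8 * (j + 1) * (2 * m) ^ 2 * s := by gcongr <;> omega
    _ = 32 * (j + 1) * (s * m ^ 2) := by ring
    _ ≤ 32 * (j + 1) * (32 * (j + 1) * s') := by gcongr
    _ = 1024 * (j + 1) ^ 2 * s' := by ring

theorem four_mul_le_of_le_i1Nat {d i : ℕ} {γ : ℝ} (hγ : 0 < γ) (hd : 2 ≤ d)
    (hi : i ≤ i1Nat d γ) : 4 * (i : ℝ) ≤ (1 + γ) * (d : ℝ) ^ 2 := by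
  have hd' : (2 : ℝ) ≤ d := by exact_mod_cast hd
  have h1 : (0 : ℤ) ≤ ⌊(1 + γ) * ((d : ℝ) - 1) ^ 2 / 4⌋ := Int.floor_nonneg.2 (by positivity)
  have h2 : (i : ℤ) ≤ ⌊(1 + γ) * ((d : ℝ) - 1) ^ 2 / 4⌋ := by
    unfold i1Nat at hi
    omega
  have h3 : (i : ℝ) ≤ (1 + γ) * ((d : ℝ) - 1) ^ 2 / 4 := by
    have := Int.le_floor.1 h2
    exact_mod_cast this
  nlinarith

theorem eventually_mul_le_of_tendsto {d : ℕ → ℕ}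
    (h : Filter.Tendsto (fun n : ℕ => (d n : ℝ) / Real.sqrt n) Filter.atTop (nhds 0))
    {A : ℝ} (hA : 0 < A) : ∀ᶠ n : ℕ in Filter.atTop, A * (d n : ℝ) ≤ n := by
  filter_upwards [h.eventually_lt_const (inv_pos.2 hA), Filter.eventually_ge_atTop 1]
    with n hn hn1
  have hn1' : (1 : ℝ) ≤ n := by exact_mod_cast hn1
  have hs : 0 < Real.sqrt n := Real.sqrt_pos.2 (by linarith)
  rw [div_lt_iff₀ hs, inv_mul_eq_div, lt_div_iff₀ hA] at hn
  have : Real.sqrt n ≤ n := Real.sqrt_le_iff.2 ⟨by positivity, by nlinarith⟩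
  linarith

/-- Lemma 8: for `P` uniformly random in `S_i` (`2 ≤ i ≤ i1`), the expected
number of unordered pairs of distinct double edges sharing a common bin is
`O(i²/n)`. -/
theorem stmt_7 (γ : ℝ) (hγ : 0 < γ) (d : ℕ → ℕ) (hd : ∀ n, 2 ≤ d n)
    (hdo : Filter.Tendsto (fun n : ℕ => (d n : ℝ) / Real.sqrt n) Filter.atTop
      (nhds 0)) :
    ∃ C : ℝ, 0 < C ∧ ∃ n0 : ℕ, ∀ n : ℕ, n0 ≤ n → Even (d n * n) →
      ∀ i : ℕ, 2 ≤ i → i ≤ i1Nat (d n) γ → (SD n (d n) i).Nonempty →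
      (∑ᶠ P ∈ SD n (d n) i, (doubleSharedOrdered P : ℝ) / 2) /
          (Nat.card {P : Pairing n (d n) // P ∈ SD n (d n) i} : ℝ)
        ≤ C * (i : ℝ) ^ 2 / (n : ℝ) := by
  obtain ⟨n0, hn0⟩ := Filter.eventually_atTop.1
    (eventually_mul_le_of_tendsto hdo (A := 8 * (13 + γ)) (by positivity))
  refine ⟨512, by norm_num, max n0 1, fun n hn _ i hi2 hi hne => ?_⟩
  have hn1 : 1 ≤ n := (le_max_right _ _).trans hn
  have hlarge := hn0 n ((le_max_left _ _).trans hn)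
  have h4i := four_mul_le_of_le_i1Nat hγ (hd n) hi
  have hdn := hd n
  generalize d n = k at *
  obtain ⟨j, rfl⟩ : ∃ j, i = j + 1 := ⟨i - 1, by omega⟩
  have hk : (2 : ℝ) ≤ k := by exact_mod_cast hdn
  have hcond : 8 * (4 * (j + 1) + 8 * k + 4 * (k * k)) ≤ n * k := by
    have h5 : (8 * (13 + γ) * k) * k ≤ (n : ℝ) * k := by gcongr
    have : (8 * (4 * ((j + 1 : ℕ) : ℝ) + 8 * k + 4 * (k * k)) : ℝ) ≤ n * k := by nlinarith
    exact_mod_cast this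
  have hmain := sum_doubleSharedOrdered_mul_le hdn hcond
  have hcard : Nat.card {P : Pairing n k // P ∈ SD n k (j + 1)} =
      (SDFinset n k (j + 1)).card :=
    (Nat.card_coe_set_eq _).trans (Set.ncard_eq_toFinset_card _ _)
  have hpos : 0 < (SDFinset n k (j + 1)).card :=
    Finset.card_pos.2 (hne.imp fun P hP => mem_SDFinset.2 hP)
  have hsum : ∑ᶠ P ∈ SD n k (j + 1), (doubleSharedOrdered P : ℝ) / 2 =
      (∑ P ∈ SDFinset n k (j + 1), doubleSharedOrdered P : ℕ) / 2 := by
    rw [finsum_mem_eq_finite_toFinset_sum _ (Set.toFinite _), ← Finset.sum_div, Nat.cast_sum]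
    rfl
  rw [hcard, hsum, div_le_div_iff₀ (by exact_mod_cast hpos) (by exact_mod_cast hn1)]
  have : ((∑ P ∈ SDFinset n k (j + 1), doubleSharedOrdered P : ℕ) : ℝ) * n ≤
      1024 * ((j + 1 : ℕ) : ℝ) ^ 2 * (SDFinset n k (j + 1)).card := by exact_mod_cast hmain
  linarith

end Reg
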